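/- Let p be a prime with p ≡ 1 (mod 4), n an even positive integer, and f : F_{p^n} → F_p a weakly regular bent function with W_f(b) = u p^{n/2} ω_p^{f*(b)} for all b (u ∈ {1,−1}; note p* = p here), such that f(tx) = t^k f(x) for all t ∈ F_p, x ∈ F_{p^n} with gcd(k−1,p−1) = 1. Then in the complex group algebra ℂ[(F_{p^n},+)] the following identities hold: (p·D_R − ((p−1)/2)·[F_{p^n}])² = ((p²−1)/4)·p^n·[0] + u·p^{n/2}·(p·D_R − ((p−1)/2)·[F_{p^n}]), and (p·D_N − ((p−1)/2)·[F_{p^n}])² = ((p²−1)/4)·p^n·[0] + u·p^{n/2}·(p·D_N − ((p−1)/2)·[F_{p^n}]). -/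

import Mathlib

open Finset

noncomputable section
open scoped Classical

noncomputable instance (p n : ℕ) [Fact p.Prime] : Fintype (GaloisField p n) :=
  Fintype.ofFinite _

/-- `ω_p^a` for `a ∈ F_p`, where `ω_p = exp(2πi/p)`. -/
def ez (p : ℕ) (a : ZMod p) : ℂ :=
  Complex.exp (2 * Real.pi * Complex.I * (a.val : ℂ) / p)

/-- The Walsh coefficient `W_f(b) = ∑_{x∈F_{p^n}} ω_p^{f(x)+Tr(bx)}`. -/
def walsh (p n : ℕ) [Fact p.Prime] (f : GaloisField p n → ZMod p) (b : GaloisField p n) : ℂ :=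
  ∑ x : GaloisField p n,
    ez p (f x + Algebra.trace (ZMod p) (GaloisField p n) (b * x))

/-- The quadratic Gauss sum `G = ∑_{t∈F_p} ω_p^{t²}`. -/
def gaussSum' (p : ℕ) [NeZero p] : ℂ := ∑ t : ZMod p, ez p (t ^ 2)

/-- The element `∑_{x∈S} x` of the group algebra `ℂ[(F_{p^n},+)]` attached to a subset `S`. -/
def elt (p n : ℕ) [Fact p.Prime] (S : Finset (GaloisField p n)) :
    AddMonoidAlgebra ℂ (GaloisField p n) :=
  ∑ x ∈ S, AddMonoidAlgebra.single x (1 : ℂ)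

lemma ez_eq_stdAddChar (p : ℕ) [NeZero p] (a : ZMod p) : ez p a = ZMod.stdAddChar a := by
  rw [ZMod.stdAddChar_apply, ZMod.toCircle_apply, ez]

/-- A nontrivial power of `ω_p` is a Galois conjugate of `ω_p`: an identity between an integral
combination of `p`-th roots of unity and an integer multiple of such a root is preserved by
multiplying all exponents by `s ≠ 0`. -/
lemma sum_stdAddChar_mul_of_sum_stdAddChar (p : ℕ) [Fact p.Prime] {ι : Type*} (T : Finset ι)
    (g : ι → ZMod p) (c : ℤ) (a s : ZMod p) (hs : s ≠ 0)
    (h : ∑ x ∈ T, (ZMod.stdAddChar (g x) : ℂ) = c * ZMod.stdAddChar a) :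
    ∑ x ∈ T, (ZMod.stdAddChar (s * g x) : ℂ) = c * ZMod.stdAddChar (s * a) := by
  have hp : p.Prime := Fact.out
  have hprim (t : ZMod p) (ht : t ≠ 0) : IsPrimitiveRoot (ZMod.stdAddChar t : ℂ) p := by
    rw [IsPrimitiveRoot.iff_orderOf]
    refine orderOf_eq_prime ?_ ?_
    · rw [← AddChar.map_nsmul_eq_pow]
      simp
    · intro h1
      exact ht (ZMod.injective_stdAddChar (h1.trans (AddChar.map_zero_eq_one _).symm))
  set Q : Polynomial ℤ :=
    ∑ x ∈ T, Polynomial.X ^ (g x).val - Polynomial.C c * Polynomial.X ^ a.val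
  have key (t : ZMod p) : Polynomial.aeval (ZMod.stdAddChar t : ℂ) Q =
      ∑ x ∈ T, (ZMod.stdAddChar (t * g x) : ℂ) - c * ZMod.stdAddChar (t * a) := by
    have hpow (b : ZMod p) : (ZMod.stdAddChar t : ℂ) ^ b.val = ZMod.stdAddChar (t * b) := by
      rw [← AddChar.map_nsmul_eq_pow, nsmul_eq_mul, ZMod.natCast_zmod_val, mul_comm]
    simp [Q, hpow]
  have h0 : Polynomial.aeval (ZMod.stdAddChar (1 : ZMod p) : ℂ) Q = 0 := by
    rw [key]
    simp [h]
  have hdvd : Polynomial.cyclotomic p ℤ ∣ Q := by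
    rw [Polynomial.cyclotomic_eq_minpoly (hprim 1 one_ne_zero) hp.pos]
    exact minpoly.isIntegrallyClosed_dvd ((hprim 1 one_ne_zero).isIntegral hp.pos) h0
  have hroot : Polynomial.aeval (ZMod.stdAddChar s : ℂ) Q = 0 := by
    rw [Polynomial.cyclotomic_eq_minpoly (hprim s hs) hp.pos] at hdvd
    exact Polynomial.aeval_eq_zero_of_dvd_aeval_eq_zero hdvd (minpoly.aeval _ _)
  rw [key, sub_eq_zero] at hroot
  exact hroot

/-- The canonical additive character `x ↦ ω_p^{Tr(x)}` of `F_{p^n}`. -/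
def traceChar (p n : ℕ) [Fact p.Prime] : AddChar (GaloisField p n) ℂ :=
  (ZMod.stdAddChar (N := p)).compAddMonoidHom
    (Algebra.trace (ZMod p) (GaloisField p n)).toAddMonoidHom

lemma traceChar_apply (p n : ℕ) [Fact p.Prime] (x : GaloisField p n) :
    traceChar p n x = ZMod.stdAddChar (Algebra.trace (ZMod p) (GaloisField p n) x) := rfl

lemma traceChar_isPrimitive (p n : ℕ) [Fact p.Prime] : (traceChar p n).IsPrimitive := by
  refine AddChar.IsPrimitive.of_ne_one fun h => ?_
  obtain ⟨x, hx⟩ := Algebra.trace_surjective (ZMod p) (GaloisField p n) 1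
  have h1 : (ZMod.stdAddChar (1 : ZMod p) : ℂ) = 1 := by
    rw [← hx, ← traceChar_apply, h, AddChar.one_apply]
  exact one_ne_zero (ZMod.injective_stdAddChar (h1.trans (AddChar.map_zero_eq_one _).symm))

/-- Evaluation of the group algebra of `F_{p^n}` at the character `x ↦ ω_p^{Tr(bx)}`. -/
def charEval (p n : ℕ) [Fact p.Prime] (b : GaloisField p n) :
    AddMonoidAlgebra ℂ (GaloisField p n) →ₐ[ℂ] ℂ :=
  AddMonoidAlgebra.lift ℂ ℂ (GaloisField p n) ((traceChar p n).mulShift b).toMonoidHom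

lemma charEval_single (p n : ℕ) [Fact p.Prime] (b x : GaloisField p n) (c : ℂ) :
    charEval p n b (AddMonoidAlgebra.single x c) = c * traceChar p n (b * x) := by
  simp [charEval, AddMonoidAlgebra.lift_single, AddChar.mulShift_apply]

lemma charEval_elt (p n : ℕ) [Fact p.Prime] (b : GaloisField p n) (S : Finset (GaloisField p n)) :
    charEval p n b (elt p n S) = ∑ x ∈ S, traceChar p n (b * x) := by
  simp [elt, charEval_single]

lemma charEval_eq_sum (p n : ℕ) [Fact p.Prime] (b : GaloisField p n)
    (A : AddMonoidAlgebra ℂ (GaloisField p n)) :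
    charEval p n b A = ∑ x, A.coeff x * traceChar p n (b * x) := by
  rw [charEval, AddMonoidAlgebra.lift_apply, Finsupp.sum_fintype _ _ (by simp)]
  simp [AddChar.mulShift_apply]

/-- Fourier inversion: elements of the group algebra are determined by their character values. -/
lemma ext_charEval (p n : ℕ) [Fact p.Prime] {A B : AddMonoidAlgebra ℂ (GaloisField p n)}
    (h : ∀ b, charEval p n b A = charEval p n b B) : A = B := by
  have inv (C : AddMonoidAlgebra ℂ (GaloisField p n)) (y : GaloisField p n) :
      ∑ b, charEval p n b C * traceChar p n (b * -y)
        = C.coeff y * Fintype.card (GaloisField p n) := by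
    simp_rw [charEval_eq_sum, Finset.sum_mul]
    rw [Finset.sum_comm]
    have (x : GaloisField p n) :
        ∑ b, C.coeff x * traceChar p n (b * x) * traceChar p n (b * -y)
          = if x = y then C.coeff x * Fintype.card (GaloisField p n) else 0 := by
      simp_rw [mul_assoc, ← AddChar.map_add_eq_mul, ← mul_add, ← sub_eq_add_neg]
      rw [← Finset.mul_sum, AddChar.sum_mulShift _ (traceChar_isPrimitive p n)]
      simp [sub_eq_zero]
    simp_rw [this]
    simp
  ext y
  have hcard : (Fintype.card (GaloisField p n) : ℂ) ≠ 0 :=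
    Nat.cast_ne_zero.mpr Fintype.card_ne_zero
  apply mul_right_cancel₀ hcard
  rw [← inv, ← inv]
  simp [h]

lemma sum_zmod_eq_zero_add_sum_units (p : ℕ) [Fact p.Prime] (F : ZMod p → ℂ) :
    ∑ t, F t = F 0 + ∑ t : (ZMod p)ˣ, F t := by
  rw [← Finset.add_sum_erase _ _ (Finset.mem_univ (0 : ZMod p))]
  congr 1
  rw [← Finset.sum_coe_sort]
  symm
  refine Fintype.sum_equiv (unitsEquivNeZero.trans (Equiv.subtypeEquivRight (by simp))) _ _ ?_
  intro x
  rfl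

lemma sum_sum_stdAddChar_sub (p : ℕ) [Fact p.Prime] (S : Finset (ZMod p)) (a : ZMod p) :
    ∑ i ∈ S, ∑ t, (ZMod.stdAddChar (t * (a - i)) : ℂ) = if a ∈ S then (p : ℂ) else 0 := by
  simp_rw [AddChar.sum_mulShift _ (ZMod.isPrimitive_stdAddChar p), sub_eq_zero]
  simp [ZMod.card]

/-- For a union `S` of cosets of the nonzero squares, the character values of the preimage of `S`
under a homogeneous weakly regular bent function are governed by the dual function. -/
lemma sum_traceChar_preimage (p n : ℕ) [Fact p.Prime] (hp : Odd p)
    (f fstar : GaloisField p n → ZMod p) (c : ℤ)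
    (hW : ∀ b, walsh p n f b = c * ez p (fstar b))
    (k : ℕ) (hk : 0 < k) (hkgcd : Nat.gcd (k - 1) (p - 1) = 1)
    (hhom : ∀ (t : ZMod p) (x : GaloisField p n),
      f (algebraMap (ZMod p) (GaloisField p n) t * x) = t ^ k * f x)
    (S : Finset (ZMod p)) (hS : ∀ i ∈ S, ∀ r : (ZMod p)ˣ, (r : ZMod p) ^ 2 * i ∈ S)
    (b : GaloisField p n) :
    (p : ℂ) * ∑ x with f x ∈ S, traceChar p n (b * x)
        - S.card * ∑ x, traceChar p n (b * x)
      = c * ((if fstar b ∈ S then (p : ℂ) else 0) - S.card) := by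
  have hcop : (Nat.card (ZMod p)ˣ).Coprime (k - 1) := by
    rw [Nat.card_eq_fintype_card, ZMod.card_units]
    exact Nat.Coprime.symm hkgcd
  have hkeven : Even k := by
    obtain ⟨m, hm⟩ := hp
    by_contra hodd
    obtain ⟨j, hj⟩ := Nat.not_even_iff_odd.mp hodd
    have : 2 ∣ Nat.gcd (k - 1) (p - 1) := Nat.dvd_gcd ⟨j, by omega⟩ ⟨m, by omega⟩
    rw [hkgcd] at this
    omega
  obtain ⟨j, hj⟩ := hkeven
  -- the reparametrisation `s ↦ s^{-(k-1)}` of the units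
  let e : (ZMod p)ˣ ≃ (ZMod p)ˣ := (powCoprime hcop).trans (Equiv.inv _)
  have he (s : (ZMod p)ˣ) : e s = (s ^ (k - 1))⁻¹ := rfl
  have he1 (s : (ZMod p)ˣ) : e s * s ^ k = s := by
    rw [he, inv_mul_eq_iff_eq_mul, ← pow_succ, Nat.sub_add_cancel hk]
  have he2 (s : (ZMod p)ˣ) : e s * (s ^ j) ^ 2 = s := by
    rw [← pow_mul, mul_two, ← hj, he1]
  have hT (s : (ZMod p)ˣ) :
      ∑ x, (ZMod.stdAddChar ((e s : ZMod p) * f x) : ℂ) * traceChar p n (b * x)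
        = c * ZMod.stdAddChar ((s : ZMod p) * fstar b) := by
    have hs0 : algebraMap (ZMod p) (GaloisField p n) s ≠ 0 := by simp
    rw [← Equiv.sum_comp (Equiv.mulLeft₀ _ hs0), ← sum_stdAddChar_mul_of_sum_stdAddChar p Finset.univ
      (fun x => f x + Algebra.trace (ZMod p) (GaloisField p n) (b * x)) c (fstar b) s s.ne_zero]
    · refine Finset.sum_congr rfl fun x _ => ?_
      rw [Equiv.mulLeft₀_apply, hhom, traceChar_apply, ← AddChar.map_add_eq_mul, ← mul_assoc,
        mul_left_comm b, ← Algebra.smul_def, map_smul, smul_eq_mul, mul_add]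
      congr 3
      exact_mod_cast congrArg Units.val (he1 s)
    · have := hW b
      simp only [walsh, ez_eq_stdAddChar] at this
      exact this
  have hSsum (s : (ZMod p)ˣ) :
      ∑ i ∈ S, (ZMod.stdAddChar (-((e s : ZMod p) * i)) : ℂ)
        = ∑ i ∈ S, (ZMod.stdAddChar (-((s : ZMod p) * i)) : ℂ) := by
    symm
    refine Finset.sum_bij' (fun i _ => ((s ^ j : (ZMod p)ˣ) : ZMod p) ^ 2 * i)
      (fun i _ => (((s ^ j)⁻¹ : (ZMod p)ˣ) : ZMod p) ^ 2 * i)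
      (fun i hi => hS i hi _) (fun i hi => hS i hi _) ?_ ?_ ?_
    · intro i _
      rw [← mul_assoc, ← mul_pow, Units.inv_mul, one_pow, one_mul]
    · intro i _
      rw [← mul_assoc, ← mul_pow, Units.mul_inv, one_pow, one_mul]
    · intro i _
      congr 2
      rw [← mul_assoc]
      congr 1
      exact_mod_cast (congrArg Units.val (he2 s)).symm
  have hexpand : (p : ℂ) * ∑ x with f x ∈ S, traceChar p n (b * x)
      = ∑ t : ZMod p, (∑ i ∈ S, (ZMod.stdAddChar (-(t * i)) : ℂ)) *
          ∑ x, (ZMod.stdAddChar (t * f x) : ℂ) * traceChar p n (b * x) := by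
    rw [Finset.sum_filter, Finset.mul_sum]
    simp_rw [Finset.mul_sum]
    rw [Finset.sum_comm]
    refine Finset.sum_congr rfl fun x _ => ?_
    have h := sum_sum_stdAddChar_sub p S (f x)
    rw [Finset.sum_comm] at h
    trans (if f x ∈ S then (p : ℂ) else 0) * traceChar p n (b * x)
    · split_ifs <;> simp
    rw [← h, Finset.sum_mul]
    refine Finset.sum_congr rfl fun t _ => ?_
    rw [← mul_assoc, Finset.sum_mul, Finset.sum_mul, Finset.sum_mul]
    refine Finset.sum_congr rfl fun i _ => ?_
    rw [← AddChar.map_add_eq_mul]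
    congr 2
    ring
  have hdual := sum_sum_stdAddChar_sub p S (fstar b)
  rw [Finset.sum_comm, sum_zmod_eq_zero_add_sum_units] at hdual
  rw [hexpand, sum_zmod_eq_zero_add_sum_units, ← e.sum_comp]
  simp_rw [hT, hSsum]
  simp only [zero_mul, neg_zero, AddChar.map_zero_eq_one, Finset.sum_const, nsmul_eq_mul, mul_one,
    one_mul] at hdual ⊢
  rw [← hdual, add_sub_cancel_left, add_sub_cancel_left, Finset.mul_sum]
  refine Finset.sum_congr rfl fun s _ => ?_
  rw [mul_left_comm, Finset.sum_mul]
  congr 1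
  refine Finset.sum_congr rfl fun i _ => ?_
  rw [← AddChar.map_add_eq_mul]
  congr 1
  ring

/-- The quadratic group ring identity for the preimage of a union of cosets of the nonzero squares
of size `(p-1)/2`. -/
lemma group_ring_identity_preimage (p n : ℕ) [Fact p.Prime] (hp : Odd p) (hneven : Even n)
    (f fstar : GaloisField p n → ZMod p) (u : ℤ) (hu : u = 1 ∨ u = -1)
    (hW : ∀ b : GaloisField p n,
      walsh p n f b = (u : ℂ) * (p : ℂ) ^ (n / 2) * ez p (fstar b))
    (k : ℕ) (hk : 0 < k) (hkgcd : Nat.gcd (k - 1) (p - 1) = 1)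
    (hhom : ∀ (t : ZMod p) (x : GaloisField p n),
      f (algebraMap (ZMod p) (GaloisField p n) t * x) = t ^ k * f x)
    (S : Finset (ZMod p)) (hS : ∀ i ∈ S, ∀ r : (ZMod p)ˣ, (r : ZMod p) ^ 2 * i ∈ S)
    (hcard : (S.card : ℂ) = ((p : ℂ) - 1) / 2) :
    ((p : ℂ) • elt p n (Finset.univ.filter fun x => f x ∈ S)
        - (((p : ℂ) - 1) / 2) • elt p n Finset.univ) ^ 2
      = (((p : ℂ) ^ 2 - 1) / 4 * (p : ℂ) ^ n) • (1 : AddMonoidAlgebra ℂ (GaloisField p n))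
        + ((u : ℂ) * (p : ℂ) ^ (n / 2)) •
            ((p : ℂ) • elt p n (Finset.univ.filter fun x => f x ∈ S)
              - (((p : ℂ) - 1) / 2) • elt p n Finset.univ) := by
  refine ext_charEval p n fun b => ?_
  have h := sum_traceChar_preimage p n hp f fstar (u * (p : ℤ) ^ (n / 2))
    (by simpa using hW) k hk hkgcd hhom S hS b
  have hpn : (p : ℂ) ^ n = ((p : ℂ) ^ (n / 2)) ^ 2 := by
    rw [← pow_mul, Nat.div_mul_cancel hneven.two_dvd]
  have hu2 : (u : ℂ) ^ 2 = 1 := by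
    rcases hu with rfl | rfl <;> simp
  simp only [map_pow, map_add, map_sub, map_smul, map_one, charEval_elt, smul_eq_mul]
  rw [hcard] at h
  push_cast at h
  rw [h, hpn]
  split_ifs
  · linear_combination (((p : ℂ) ^ (n / 2)) ^ 2 * ((p : ℂ) ^ 2 - 1) / 4) * hu2
  · linear_combination (((p : ℂ) ^ (n / 2)) ^ 2 * ((p : ℂ) ^ 2 - 1) / 4) * hu2

lemma card_nonzero_squares_and_nonsquares (p : ℕ) [Fact p.Prime] (hp : p ≠ 2) :
    (((Finset.univ.filter fun i : ZMod p => i ≠ 0 ∧ IsSquare i).card : ℂ) = ((p : ℂ) - 1) / 2) ∧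
    (((Finset.univ.filter fun i : ZMod p => ¬IsSquare i).card : ℂ) = ((p : ℂ) - 1) / 2) := by
  have hsum := quadraticChar_sum_zero (F := ZMod p) (by rwa [ZMod.ringChar_zmod_n])
  have h1 : ∑ a : ZMod p, ((if a ≠ 0 ∧ IsSquare a then 1 else 0 : ℤ) -
      if ¬IsSquare a then 1 else 0) = 0 := by
    refine Eq.trans ?_ hsum
    refine Finset.sum_congr rfl fun a _ => ?_
    rw [quadraticChar_apply, quadraticCharFun]
    by_cases ha : a = 0
    · simp [ha]
    · by_cases hq : IsSquare a <;> simp [ha, hq]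
  have h2 : ∑ a : ZMod p, ((if a ≠ 0 ∧ IsSquare a then 1 else 0 : ℤ) +
      (if ¬IsSquare a then 1 else 0) + if a = 0 then 1 else 0) = p := by
    have (a : ZMod p) : ((if a ≠ 0 ∧ IsSquare a then 1 else 0 : ℤ) +
      (if ¬IsSquare a then 1 else 0) + if a = 0 then 1 else 0) = 1 := by
      by_cases ha : a = 0
      · simp [ha]
      · by_cases hq : IsSquare a <;> simp [ha, hq]
    simp_rw [this]
    simp [ZMod.card]
  rw [Finset.sum_sub_distrib, Finset.sum_boole, Finset.sum_boole] at h1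
  rw [Finset.sum_add_distrib, Finset.sum_add_distrib, Finset.sum_boole, Finset.sum_boole,
    Finset.sum_ite_eq' Finset.univ (0 : ZMod p), if_pos (Finset.mem_univ _)] at h2
  have h1' := congrArg (Int.cast : ℤ → ℂ) h1
  have h2' := congrArg (Int.cast : ℤ → ℂ) h2
  push_cast at h1' h2'
  constructor
  · linear_combination (h1' + h2') / 2
  · linear_combination (h2' - h1') / 2

/-- **Case 1 of the proof of Theorem 3.5** (`p ≡ 1 (mod 4)`): in `ℂ[(F_{p^n},+)]`,
`(pD_R − ((p−1)/2)[F_{p^n}])² = ((p²−1)/4)p^n·[0] + u p^{n/2}(pD_R − ((p−1)/2)[F_{p^n}])`,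
and the same identity holds with `D_R` replaced by `D_N`. -/
theorem DR_DN_group_ring_identity_one_mod_four
    (p : ℕ) [Fact p.Prime] (hp4 : p % 4 = 1) (n : ℕ) (hn : 0 < n) (hneven : Even n)
    (f fstar : GaloisField p n → ZMod p) (u : ℤ) (hu : u = 1 ∨ u = -1)
    (hW : ∀ b : GaloisField p n,
      walsh p n f b = (u : ℂ) * (p : ℂ) ^ (n / 2) * ez p (fstar b))
    (k : ℕ) (hk : 0 < k) (hkgcd : Nat.gcd (k - 1) (p - 1) = 1)
    (hhom : ∀ (t : ZMod p) (x : GaloisField p n),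
      f (algebraMap (ZMod p) (GaloisField p n) t * x) = t ^ k * f x) :
    ((p : ℂ) • elt p n (Finset.univ.filter fun x => f x ≠ 0 ∧ IsSquare (f x))
        - (((p : ℂ) - 1) / 2) • elt p n Finset.univ) ^ 2
      = (((p : ℂ) ^ 2 - 1) / 4 * (p : ℂ) ^ n) • (1 : AddMonoidAlgebra ℂ (GaloisField p n))
        + ((u : ℂ) * (p : ℂ) ^ (n / 2)) •
            ((p : ℂ) • elt p n (Finset.univ.filter fun x => f x ≠ 0 ∧ IsSquare (f x))
              - (((p : ℂ) - 1) / 2) • elt p n Finset.univ) ∧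
    ((p : ℂ) • elt p n (Finset.univ.filter fun x => ¬IsSquare (f x))
        - (((p : ℂ) - 1) / 2) • elt p n Finset.univ) ^ 2
      = (((p : ℂ) ^ 2 - 1) / 4 * (p : ℂ) ^ n) • (1 : AddMonoidAlgebra ℂ (GaloisField p n))
        + ((u : ℂ) * (p : ℂ) ^ (n / 2)) •
            ((p : ℂ) • elt p n (Finset.univ.filter fun x => ¬IsSquare (f x))
              - (((p : ℂ) - 1) / 2) • elt p n Finset.univ) := by
  have hp2 : p ≠ 2 := by omega
  have hp : Odd p := (Fact.out : p.Prime).odd_of_ne_two hp2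
  obtain ⟨hR, hN⟩ := card_nonzero_squares_and_nonsquares p hp2
  have hsq (r : (ZMod p)ˣ) (i : ZMod p) (h : IsSquare ((r : ZMod p) ^ 2 * i)) : IsSquare i := by
    have h' := (IsSquare.sq ((r⁻¹ : (ZMod p)ˣ) : ZMod p)).mul h
    rwa [← mul_assoc, ← mul_pow, Units.inv_mul, one_pow, one_mul] at h'
  constructor
  · have h := group_ring_identity_preimage p n hp hneven f fstar u hu hW k hk hkgcd hhom
      (Finset.univ.filter fun i : ZMod p => i ≠ 0 ∧ IsSquare i) (fun i hi r => by
        simp only [Finset.mem_filter, Finset.mem_univ, true_and] at hi ⊢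
        exact ⟨mul_ne_zero (pow_ne_zero _ r.ne_zero) hi.1, (IsSquare.sq _).mul hi.2⟩) hR
    simpa only [Finset.mem_filter, Finset.mem_univ, true_and] using h
  · have h := group_ring_identity_preimage p n hp hneven f fstar u hu hW k hk hkgcd hhom
      (Finset.univ.filter fun i : ZMod p => ¬IsSquare i) (fun i hi r => by
        simp only [Finset.mem_filter, Finset.mem_univ, true_and] at hi ⊢
        exact fun h => hi (hsq r i h)) hN
    simpa only [Finset.mem_filter, Finset.mem_univ, true_and] using h
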